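/- Let (Ω, ℱ, P) be a probability space, T, M, M₀ > 0, and let X : [0,T] × Ω → ℝ^d be a process such that for every ω the path t ↦ X(t,ω) is absolutely continuous with ‖∂_t X(t,ω)‖ ≤ M(1 + ‖X(t,ω)‖ + (E‖X(t)‖²)^{1/2}) for almost every t, the function t ↦ E‖X(t)‖² is finite and measurable, and E‖X(0)‖² ≤ M₀. Then there exists a constant C₂ depending only on M₀, M, T such that E‖X(t)‖² ≤ C₂ for every t ∈ [0,T]. -/

import Mathlib

open MeasureTheory

/-- local bootstrap for a single path -/
lemma path_bound {E : Type*} [NormedAddCommGroup E] [NormedSpace ℝ E]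
    {T M S a b : ℝ} (hM : 0 < M) (hS : 0 ≤ S) (ha : 0 ≤ a) (hb : b ≤ T)
    (hd : M * (b - a) ≤ 1 / 8) (x v : ℝ → E)
    (hv : IntervalIntegrable v volume 0 T)
    (hx : ∀ t ∈ Set.Icc (0:ℝ) T, x t = x 0 + ∫ τ in (0:ℝ)..t, v τ)
    (hc : ContinuousOn x (Set.Icc 0 T))
    (hbd : ∀ᵐ t ∂(volume.restrict (Set.Icc (0:ℝ) T)), t ∈ Set.Icc a b →
      ‖v t‖ ≤ M * (1 + ‖x t‖ + S))
    (p q : ℝ) (hp : p ∈ Set.Icc a b) (hq : q ∈ Set.Icc a b) :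
    ‖x q‖ ≤ 8 / 7 * ‖x p‖ + (1 + S) / 7 := by
  have hsub : Set.Icc a b ⊆ Set.Icc 0 T := Set.Icc_subset_Icc ha hb
  have hT : 0 ≤ T := (hsub hp).1.trans (hsub hp).2
  obtain ⟨r, hr, hmax⟩ := isCompact_Icc.exists_isMaxOn ⟨p, hp⟩ ((hc.mono hsub).norm)
  have hmax' : ∀ t ∈ Set.Icc a b, ‖x t‖ ≤ ‖x r‖ := fun t ht => hmax ht
  have hint : ∀ t ∈ Set.Icc a b, IntervalIntegrable v volume 0 t := fun t ht =>
    hv.mono_set (by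
      rw [Set.uIcc_of_le (hsub ht).1, Set.uIcc_of_le hT]
      exact Set.Icc_subset_Icc le_rfl (hsub ht).2)
  have hdiff : x r - x p = ∫ τ in p..r, v τ := by
    rw [hx r (hsub hr), hx p (hsub hp),
      ← intervalIntegral.integral_interval_sub_left (hint r hr) (hint p hp)]
    abel
  have hI : Set.uIoc p r ⊆ Set.Icc a b :=
    Set.uIoc_subset_uIcc.trans (Set.uIcc_subset_Icc hp hr)
  have hn : ‖∫ τ in p..r, v τ‖ ≤ M * (1 + ‖x r‖ + S) * |r - p| := by
    apply intervalIntegral.norm_integral_le_of_norm_le_const_ae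
    rw [ae_restrict_iff' measurableSet_Icc] at hbd
    filter_upwards [hbd] with t ht htI
    refine (ht (hsub (hI htI)) (hI htI)).trans ?_
    have := hmax' t (hI htI)
    gcongr
  have habs : |r - p| ≤ b - a := by
    rw [abs_le]; constructor <;> linarith [hp.1, hp.2, hr.1, hr.2]
  have h1 : M * (1 + ‖x r‖ + S) * |r - p| ≤ 1 / 8 * (1 + ‖x r‖ + S) := by
    calc M * (1 + ‖x r‖ + S) * |r - p| ≤ M * (1 + ‖x r‖ + S) * (b - a) := by gcongr
      _ = (M * (b - a)) * (1 + ‖x r‖ + S) := by ring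
      _ ≤ _ := by gcongr
  have h2 : ‖x r‖ ≤ ‖x p‖ + ‖x r - x p‖ := by
    have := norm_add_le (x p) (x r - x p)
    simpa using this
  rw [hdiff] at h2
  linarith [hmax' q hq]

/-- real-variable part: local comparison plus lower semicontinuity imply boundedness -/
lemma bdd_of_local {T δ : ℝ} (hδ : 0 < δ) (m : ℝ → ℝ)
    (h1 : ∀ a b : ℝ, 0 ≤ a → b ≤ T → b - a ≤ δ → BddAbove (m '' Set.Icc a b) →
      ∀ p ∈ Set.Icc a b, ∀ q ∈ Set.Icc a b, m q ≤ 4 * m p + 1)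
    (h2 : ∀ n : ℕ, IsClosed (Set.Icc 0 T ∩ {t | m t ≤ n})) :
    BddAbove (m '' Set.Icc 0 T) := by
  set K : Set ℝ := {t | t ∈ Set.Icc 0 T ∧ ∀ U ∈ nhds t, ¬ BddAbove (m '' (U ∩ Set.Icc 0 T))}
    with hK
  have hgood : ∀ a b : ℝ, 0 ≤ a → b ≤ T → (∀ t ∈ Set.Icc a b, t ∉ K) →
      BddAbove (m '' Set.Icc a b) := by
    intro a b ha hb hab
    refine isCompact_Icc.induction_on (p := fun s => BddAbove (m '' s)) (by simp)
      (fun s t hst ht => ht.mono (Set.image_mono hst))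
      (fun s t hs ht => by rw [Set.image_union]; exact hs.union ht) ?_
    intro t ht
    have h := hab t ht
    have htT : t ∈ Set.Icc 0 T := ⟨ha.trans ht.1, ht.2.trans hb⟩
    simp only [hK, Set.mem_setOf_eq, not_and, not_forall, not_not] at h
    obtain ⟨U, hU, hUb⟩ := h htT
    refine ⟨U ∩ Set.Icc a b, ?_, hUb.mono (Set.image_mono ?_)⟩
    · rw [Set.inter_comm]; exact inter_mem_nhdsWithin _ hU
    · exact Set.inter_subset_inter_right _ (Set.Icc_subset_Icc ha hb)
  have hKc : IsClosed K := by
    have : K = Set.Icc 0 T ∩ {t | ∃ U ∈ nhds t, BddAbove (m '' (U ∩ Set.Icc 0 T))}ᶜ := by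
      ext t; simp [hK]
    rw [this]
    refine isClosed_Icc.inter (IsOpen.isClosed_compl ?_)
    rw [isOpen_iff_mem_nhds]
    rintro t ⟨U, hU, hb⟩
    filter_upwards [eventually_mem_nhds_iff.2 hU] with y hy
    exact ⟨U, hy, hb⟩
  by_contra hcon
  have hne : K.Nonempty := by
    by_contra h
    rw [Set.not_nonempty_iff_eq_empty] at h
    exact hcon (hgood 0 T le_rfl le_rfl (by simp [h]))
  have : Nonempty K := hne.to_subtype
  have : CompleteSpace K := hKc.isComplete.completeSpace_coe
  obtain ⟨n, x, hx⟩ := nonempty_interior_of_iUnion_of_closed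
    (f := fun n : ℕ => ((↑) : K → ℝ) ⁻¹' (Set.Icc 0 T ∩ {t | m t ≤ n}))
    (fun n => (h2 n).preimage continuous_subtype_val) (by
      ext y
      obtain ⟨n, hn⟩ := exists_nat_ge (m y)
      simp only [Set.mem_iUnion, Set.mem_univ, iff_true]
      exact ⟨n, y.2.1, hn⟩)
  rw [mem_interior_iff_mem_nhds, Metric.mem_nhds_iff] at hx
  obtain ⟨ε, hε, hball⟩ := hx
  have hKn : ∀ y ∈ K, |y - x| < ε → m y ≤ n := fun y hy hd =>
    (hball (show (⟨y, hy⟩ : K) ∈ Metric.ball x ε from hd)).2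
  obtain ⟨hxT, hxU⟩ := x.2
  refine hxU (Metric.ball (x:ℝ) (min ε δ)) (Metric.ball_mem_nhds _ (lt_min hε hδ)) ⟨4 * n + 1, ?_⟩
  rintro _ ⟨t, ⟨ht, htT⟩, rfl⟩
  rw [Metric.mem_ball, Real.dist_eq, lt_min_iff] at ht
  have hn0 : (0:ℝ) ≤ n := n.cast_nonneg
  obtain ⟨hx1, hx2⟩ := abs_lt.1 ht.1
  obtain ⟨hx3, hx4⟩ := abs_lt.1 ht.2
  rcases le_total t x with hle | hle
  · obtain ⟨a, ⟨haK, haI⟩, hamin⟩ := (isCompact_Icc.inter_left hKc :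
      IsCompact (K ∩ Set.Icc t x)).exists_isLeast ⟨x, x.2, hle, le_rfl⟩
    have hma : m a ≤ n := hKn a haK (by rw [abs_lt]; constructor <;> linarith [haI.1, haI.2])
    have hb : BddAbove (m '' Set.Icc t a) := by
      refine ⟨max (4 * m t + 1) (m a), ?_⟩
      rintro _ ⟨r, hr, rfl⟩
      rcases hr.2.eq_or_lt with rfl | hlt
      · exact le_max_right _ _
      · refine le_max_of_le_left ?_
        refine h1 t r htT.1 (hr.2.trans haK.1.2) (by linarith [haI.2]) ?_ t ⟨le_rfl, hr.1⟩ r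
          ⟨hr.1, le_rfl⟩
        refine hgood t r htT.1 (hr.2.trans haK.1.2) fun y hy hyK => ?_
        have := hamin ⟨hyK, hy.1, hy.2.trans (hr.2.trans haI.2)⟩
        linarith [hy.2]
    have := h1 t a htT.1 haK.1.2 (by linarith [haI.2]) hb a ⟨haI.1, le_rfl⟩ t ⟨le_rfl, haI.1⟩
    linarith
  · obtain ⟨a, ⟨haK, haI⟩, hamax⟩ := (isCompact_Icc.inter_left hKc :
      IsCompact (K ∩ Set.Icc x t)).exists_isGreatest ⟨x, x.2, le_rfl, hle⟩
    have hma : m a ≤ n := hKn a haK (by rw [abs_lt]; constructor <;> linarith [haI.1, haI.2])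
    have hb : BddAbove (m '' Set.Icc a t) := by
      refine ⟨max (4 * m t + 1) (m a), ?_⟩
      rintro _ ⟨r, hr, rfl⟩
      rcases hr.1.eq_or_lt with rfl | hlt
      · exact le_max_right _ _
      · refine le_max_of_le_left ?_
        refine h1 r t (haK.1.1.trans hr.1) htT.2 (by linarith [haI.1]) ?_ t ⟨hr.2, le_rfl⟩ r
          ⟨le_rfl, hr.2⟩
        refine hgood r t (haK.1.1.trans hr.1) htT.2 fun y hy hyK => ?_
        have := hamax ⟨hyK, haI.1.trans (hr.1.trans hy.1), hy.2⟩
        linarith [hy.1]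
    have := h1 a t haK.1.1 htT.2 (by linarith [haI.1]) hb a ⟨le_rfl, haI.2⟩ t ⟨haI.2, le_rfl⟩
    linarith

/-- lower semicontinuity of the second moment (Fatou) -/
lemma closed_sublevel {Ω E : Type*} [MeasurableSpace Ω] [NormedAddCommGroup E] (P : Measure Ω)
    {T : ℝ} (X : ℝ → Ω → E) (hc : ∀ ω, ContinuousOn (fun t => X t ω) (Set.Icc 0 T))
    (hi : ∀ t ∈ Set.Icc (0:ℝ) T, Integrable (fun ω => ‖X t ω‖ ^ 2) P) (c : ℝ) (hc0 : 0 ≤ c) :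
    IsClosed (Set.Icc 0 T ∩ {t | ∫ ω, ‖X t ω‖ ^ 2 ∂P ≤ c}) := by
  have hconv : ∀ t ∈ Set.Icc (0:ℝ) T, (∫ ω, ‖X t ω‖ ^ 2 ∂P ≤ c ↔
      ∫⁻ ω, ENNReal.ofReal (‖X t ω‖ ^ 2) ∂P ≤ ENNReal.ofReal c) := by
    intro t ht
    rw [← ofReal_integral_eq_lintegral_ofReal (hi t ht)
      (Filter.Eventually.of_forall fun ω => by positivity), ENNReal.ofReal_le_ofReal_iff hc0]
  refine IsSeqClosed.isClosed fun u t hu hut => ?_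
  have htT : t ∈ Set.Icc 0 T := isClosed_Icc.mem_of_tendsto hut
    (Filter.Eventually.of_forall fun n => (hu n).1)
  refine ⟨htT, (hconv t htT).2 ?_⟩
  have hlim : ∀ ω, Filter.Tendsto (fun n => ENNReal.ofReal (‖X (u n) ω‖ ^ 2)) Filter.atTop
      (nhds (ENNReal.ofReal (‖X t ω‖ ^ 2))) := by
    intro ω
    have h := (hc ω t htT).tendsto.comp (tendsto_nhdsWithin_iff.2
      ⟨hut, Filter.Eventually.of_forall fun n => (hu n).1⟩)
    exact ENNReal.tendsto_ofReal (h.norm.pow 2)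
  calc ∫⁻ ω, ENNReal.ofReal (‖X t ω‖ ^ 2) ∂P
      = ∫⁻ ω, Filter.liminf (fun n => ENNReal.ofReal (‖X (u n) ω‖ ^ 2)) Filter.atTop ∂P := by
        simp_rw [(hlim _).liminf_eq]
    _ ≤ Filter.liminf (fun n => ∫⁻ ω, ENNReal.ofReal (‖X (u n) ω‖ ^ 2) ∂P) Filter.atTop :=
        lintegral_liminf_le' fun n => (hi _ (hu n).1).aemeasurable.ennreal_ofReal
    _ ≤ Filter.liminf (fun _ : ℕ => ENNReal.ofReal c) Filter.atTop :=
        Filter.liminf_le_liminf (Filter.Eventually.of_forall fun n =>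
          (hconv _ (hu n).1).1 (hu n).2)
    _ = ENNReal.ofReal c := by simp

/-- uniform second-moment bound (Lemma 2 of the paper) for a process `X`
whose paths are absolutely continuous with `‖∂ₜX(t,ω)‖ ≤ M(1 + ‖X(t,ω)‖ + (E‖X(t)‖²)^{1/2})`
a.e. and `E‖X(0)‖² ≤ M₀`: there is a constant `C₂` depending only on `M₀, M, T` (hence the
`∃ C₂` is placed before all the data of the process) with `E‖X(t)‖² ≤ C₂` on `[0,T]`. -/
theorem stmt_3 (d : ℕ) (T M M₀ : ℝ) (hT : 0 < T) (hM : 0 < M) (hM₀ : 0 < M₀) :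
    ∃ C₂ : ℝ, ∀ (Ω : Type) [MeasurableSpace Ω] (P : Measure Ω)
      [IsProbabilityMeasure P]
      (X v : ℝ → Ω → EuclideanSpace ℝ (Fin d)),
      (∀ ω, IntervalIntegrable (fun τ => v τ ω) volume 0 T) →
      (∀ ω, ∀ t ∈ Set.Icc (0:ℝ) T, X t ω = X 0 ω + ∫ τ in (0:ℝ)..t, v τ ω) →
      (∀ ω, ∀ᵐ t ∂(volume.restrict (Set.Icc (0:ℝ) T)),
          ‖v t ω‖ ≤ M * (1 + ‖X t ω‖ + Real.sqrt (∫ ω', ‖X t ω'‖ ^ 2 ∂P))) →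
      (∀ t ∈ Set.Icc (0:ℝ) T, Integrable (fun ω => ‖X t ω‖ ^ 2) P) →
      (Measurable fun t => ∫ ω, ‖X t ω‖ ^ 2 ∂P) →
      (∫ ω, ‖X 0 ω‖ ^ 2 ∂P ≤ M₀) →
      ∀ t ∈ Set.Icc (0:ℝ) T, ∫ ω, ‖X t ω‖ ^ 2 ∂P ≤ C₂ := by
  set δ : ℝ := 1 / (8 * M) with hδdef
  have hδ : 0 < δ := by positivity
  have hMδ : M * δ = 1 / 8 := by rw [hδdef]; field_simp
  obtain ⟨N, hN⟩ := exists_nat_ge (T / δ)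
  let C : ℕ → ℝ := fun k => Nat.rec M₀ (fun _ c => 4 * c + 1) k
  refine ⟨C N, ?_⟩
  intro Ω _ P _ X v hv hX hbd hi _ h0
  set m : ℝ → ℝ := fun t => ∫ ω, ‖X t ω‖ ^ 2 ∂P with hm
  have hm0 : ∀ t, 0 ≤ m t := fun t => integral_nonneg fun ω => by positivity
  have hc : ∀ ω, ContinuousOn (fun t => X t ω) (Set.Icc 0 T) := by
    intro ω
    have h := intervalIntegral.continuousOn_primitive_interval'
      (hv ω) (Set.left_mem_uIcc)
    rw [Set.uIcc_of_le hT.le] at h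
    exact (continuousOn_const.add h).congr fun t ht => hX ω t ht
  have h1 : ∀ a b : ℝ, 0 ≤ a → b ≤ T → b - a ≤ δ → BddAbove (m '' Set.Icc a b) →
      ∀ p ∈ Set.Icc a b, ∀ q ∈ Set.Icc a b, m q ≤ 4 * m p + 1 := by
    intro a b ha hb hab hB p hp q hq
    have hsub : Set.Icc a b ⊆ Set.Icc 0 T := Set.Icc_subset_Icc ha hb
    set B := sSup (m '' Set.Icc a b) with hBdef
    have hmB : ∀ t ∈ Set.Icc a b, m t ≤ B := fun t ht => le_csSup hB ⟨t, ht, rfl⟩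
    have hB0 : 0 ≤ B := (hm0 p).trans (hmB p hp)
    have hstep : ∀ r ∈ Set.Icc a b, m r ≤ 3 * m p + (1 / 10 + B / 10) := by
      intro r hr
      have hpt : ∀ ω, ‖X r ω‖ ^ 2 ≤ 3 * ‖X p ω‖ ^ 2 + (1 / 10 + B / 10) := by
        intro ω
        have h := path_bound hM (Real.sqrt_nonneg B) ha hb
          (by rw [← hMδ]; gcongr) (fun t => X t ω) (fun t => v t ω) (hv ω) (hX ω) (hc ω)
          (by
            filter_upwards [hbd ω] with t ht htI
            refine ht.trans ?_
            have := Real.sqrt_le_sqrt (hmB t htI)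
            gcongr) p r hp hr
        have hs := Real.sq_sqrt hB0
        have hs0 := Real.sqrt_nonneg B
        have h' := pow_le_pow_left₀ (norm_nonneg _) h 2
        nlinarith [sq_nonneg (8 / 7 * ‖X p ω‖ - (1 + Real.sqrt B) / 7),
          sq_nonneg (Real.sqrt B - 1), sq_nonneg ‖X p ω‖]
      have hip := hi p (hsub hp)
      calc m r ≤ ∫ ω, (3 * ‖X p ω‖ ^ 2 + (1 / 10 + B / 10)) ∂P :=
            integral_mono (hi r (hsub hr)) ((hip.const_mul 3).add (integrable_const _)) hpt
        _ = 3 * m p + (1 / 10 + B / 10) := by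
            rw [integral_add (hip.const_mul 3) (integrable_const _), integral_const_mul]
            simp [hm]
    have hBle : B ≤ 3 * m p + (1 / 10 + B / 10) := by
      refine csSup_le ⟨_, p, hp, rfl⟩ ?_
      rintro _ ⟨r, hr, rfl⟩
      exact hstep r hr
    have := hmB q hq
    have := hm0 p
    linarith
  have hbdd : BddAbove (m '' Set.Icc 0 T) := bdd_of_local hδ m h1
    fun n => closed_sublevel P X hc hi n n.cast_nonneg
  have hiter : ∀ k : ℕ, ∀ t ∈ Set.Icc 0 T, t ≤ k * δ → m t ≤ C k := by
    intro k
    induction k with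
    | zero =>
      intro t ht hk
      have : t = 0 := le_antisymm (by simpa using hk) ht.1
      subst this
      exact h0
    | succ k ih =>
      intro t ht hk
      push_cast at hk
      have hp : max 0 (t - δ) ∈ Set.Icc 0 T :=
        ⟨le_max_left _ _, max_le hT.le (by linarith [ht.2])⟩
      have hpt : max 0 (t - δ) ≤ t := max_le ht.1 (by linarith)
      have hmp := ih _ hp (max_le (by positivity) (by linarith))
      have := h1 (max 0 (t - δ)) t hp.1 ht.2 (by linarith [le_max_right 0 (t - δ)])
        (hbdd.mono (Set.image_mono (Set.Icc_subset_Icc hp.1 ht.2))) _ ⟨le_rfl, hpt⟩ t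
        ⟨hpt, le_rfl⟩
      have hC : C (k + 1) = 4 * C k + 1 := rfl
      rw [hC]; linarith
  intro t ht
  refine hiter N t ht (ht.2.trans ?_)
  rwa [div_le_iff₀ hδ] at hN
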